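/- Let 1/3 < α ≤ 1 and 0 < β ≤ 1. Let x, y, v : [0,1]² → ℝ be continuous with ‖δx‖_{α,β} < ∞, ‖v‖_∞ < ∞ and ‖δ₁v‖_{α,0} < ∞, and such that the function y^♯(s₁,s₂;t) := y(s₂,t) − y(s₁,t) − v(s₁,t)(x(s₂,t) − x(s₁,t)) satisfies sup_{s₁≠s₂,t} |y^♯(s₁,s₂;t)|/|s₂−s₁|^{2α} < ∞ (y is controlled by x in the first direction, with derivative v). Let B : [0,1]² × [0,1]² → ℝ be continuous with B(s₁,s₂;t₁,t₂) = 0 whenever s₁ = s₂ or t₁ = t₂, with sup |B(s₁,s₂;t₁,t₂)|/(|s₂−s₁|^{2α}|t₂−t₁|^{β}) < ∞, and satisfying the Chen-type relation B(s₁,s₃;t₁,t₂) − B(s₁,s₂;t₁,t₂) − B(s₂,s₃;t₁,t₂) = (x(s₂,t₁) − x(s₁,t₁))·(δx)(s₂,s₃;t₁,t₂) for all s₁,s₂,s₃,t₁,t₂ ∈ [0,1]. Then there exists a unique function I : [0,1]² × [0,1]² → ℝ, continuous and vanishing whenever s₁ = s₂ or t₁ = t₂, such that (i) I(s₁,s₃;t₁,t₂)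 = I(s₁,s₂;t₁,t₂) + I(s₂,s₃;t₁,t₂) for all s₁,s₂,s₃,t₁,t₂ (additivity in the first direction), and (ii) sup_{s₁≠s₂,t₁≠t₂} |I(s₁,s₂;t₁,t₂) − y(s₁,t₁)(δx)(s₁,s₂;t₁,t₂) − v(s₁,t₁)B(s₁,s₂;t₁,t₂)|/(|s₂−s₁|^{3α}|t₂−t₁|^{β}) < ∞. (I is the boundary rough integral ∫₁ y ∫₂ dx.) -/

import Mathlib

open Set

/-- Rectangular increment `(δf)(s₁,s₂;t₁,t₂)`. -/
def dd (f : ℝ → ℝ → ℝ) (s₁ s₂ t₁ t₂ : ℝ) : ℝ :=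
  f s₂ t₂ - f s₁ t₂ - f s₂ t₁ + f s₁ t₁

open Filter Topology

/-- A two-parameter germ on `[0,1]` that vanishes on the diagonal and whose additivity defect on
triples of points at mutual distance at most `D` is at most `C * D ^ μ`. -/
structure IsSewable (A : ℝ → ℝ → ℝ) (C μ : ℝ) : Prop where
  diag : ∀ a ∈ Icc (0 : ℝ) 1, A a a = 0
  defect : ∀ a ∈ Icc (0 : ℝ) 1, ∀ b ∈ Icc (0 : ℝ) 1, ∀ c ∈ Icc (0 : ℝ) 1, ∀ D : ℝ,
    |b - a| ≤ D → |c - b| ≤ D → |A a c - A a b - A b c| ≤ C * D ^ μ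

/-- The geometric ratio of dyadic refinement. -/
noncomputable def dyadicRatio (μ : ℝ) : ℝ := 2 * (1 / 2 : ℝ) ^ μ

lemma dyadicRatio_pos (μ : ℝ) : 0 < dyadicRatio μ := by
  unfold dyadicRatio; positivity

lemma dyadicRatio_lt_one {μ : ℝ} (hμ : 1 < μ) : dyadicRatio μ < 1 := by
  have h : (1 / 2 : ℝ) ^ μ < (1 / 2 : ℝ) ^ (1 : ℝ) :=
    Real.rpow_lt_rpow_of_exponent_gt (by norm_num) (by norm_num) hμ
  rw [Real.rpow_one] at h
  unfold dyadicRatio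
  linarith

lemma two_mul_half_rpow {μ L : ℝ} (hL : 0 ≤ L) :
    2 * (L / 2) ^ μ = dyadicRatio μ * L ^ μ := by
  rw [dyadicRatio, div_eq_mul_one_div L 2, Real.mul_rpow hL (by norm_num)]
  ring

lemma two_pow_mul_rpow (μ : ℝ) (n : ℕ) :
    (2 : ℝ) ^ n * (1 / 2 ^ n : ℝ) ^ μ = dyadicRatio μ ^ n := by
  rw [dyadicRatio, mul_pow, ← one_div_pow, ← Real.rpow_natCast (1 / 2 : ℝ) n,
    ← Real.rpow_mul (by norm_num), mul_comm (n : ℝ) μ, Real.rpow_mul (by norm_num),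
    Real.rpow_natCast]

/-- A point splitting an increasing sequence into two pieces of at most half the total length. -/
lemma exists_half_split {p : ℕ → ℝ} {m n : ℕ} (hmn : m < n) (hp : p m ≤ p n) :
    ∃ j, m ≤ j ∧ j < n ∧ p j - p m ≤ (p n - p m) / 2 ∧ p n - p (j + 1) ≤ (p n - p m) / 2 := by
  classical
  have hex : ∃ i, m < i ∧ (i = n ∨ (p n - p m) / 2 < p i - p m) := ⟨n, hmn, Or.inl rfl⟩
  obtain ⟨hi, hi'⟩ := Nat.find_spec hex
  have hle : Nat.find hex ≤ n := Nat.find_min' hex ⟨hmn, Or.inl rfl⟩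
  have hmin := @Nat.find_min _ _ hex
  generalize Nat.find hex = i at *
  obtain ⟨j, rfl⟩ : ∃ j, i = j + 1 := ⟨i - 1, by omega⟩
  refine ⟨j, by omega, by omega, ?_, ?_⟩
  · rcases eq_or_lt_of_le (show m ≤ j by omega) with rfl | hlt
    · linarith
    · have := hmin (m := j) (by omega)
      by_contra hc
      exact this ⟨hlt, Or.inr (not_le.mp hc)⟩
  · rcases hi' with h | h
    · rw [h]; linarith
    · linarith

/-- **Maximal inequality**: Riemann sums of a sewable germ stay close to the germ. -/
lemma IsSewable.abs_sum_sub_le {A : ℝ → ℝ → ℝ} {C μ : ℝ} (hA : IsSewable A C μ) (hC : 0 ≤ C)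
    (hμ : 1 < μ) {p : ℕ → ℝ} (hp : Monotone p) (hmem : ∀ k, p k ∈ Icc (0 : ℝ) 1) (m d : ℕ) :
    |∑ k ∈ Finset.Ico m (m + d), A (p k) (p (k + 1)) - A (p m) (p (m + d))|
      ≤ 2 * C / (1 - dyadicRatio μ) * (p (m + d) - p m) ^ μ := by
  have hr : 0 < 1 - dyadicRatio μ := sub_pos.mpr (dyadicRatio_lt_one hμ)
  set K := 2 * C / (1 - dyadicRatio μ) with hK
  have hK0 : 0 ≤ K := by positivity
  have hKr : K * dyadicRatio μ + 2 * C = K := by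
    rw [hK]; field_simp; ring
  induction d using Nat.strong_induction_on generalizing m with
  | _ d ih =>
  rcases Nat.eq_zero_or_pos d with rfl | hd
  · have := Real.rpow_nonneg (le_refl (0 : ℝ)) μ
    simp only [add_zero, Finset.Ico_self, Finset.sum_empty, hA.diag _ (hmem m), sub_self,
      abs_zero]
    positivity
  set n := m + d with hn
  have hL : 0 ≤ p n - p m := sub_nonneg.mpr (hp (by omega))
  obtain ⟨j, hmj, hjn, h1, h2⟩ := exists_half_split (p := p) (show m < n by omega)
    (hp (by omega))
  have hj0 : p m ≤ p j := hp hmj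
  have hj1 : p j ≤ p (j + 1) := hp (by omega)
  have hj2 : p (j + 1) ≤ p n := hp (by omega)
  have i1 := ih (j - m) (by omega) m
  have i2 := ih (n - (j + 1)) (by omega) (j + 1)
  rw [show m + (j - m) = j by omega] at i1
  rw [show j + 1 + (n - (j + 1)) = n by omega] at i2
  have e1 := hA.defect _ (hmem m) _ (hmem j) _ (hmem n) (p n - p m)
    (by rw [abs_of_nonneg] <;> linarith) (by rw [abs_of_nonneg] <;> linarith)
  have e2 := hA.defect _ (hmem j) _ (hmem (j + 1)) _ (hmem n) (p n - p m)
    (by rw [abs_of_nonneg] <;> linarith) (by rw [abs_of_nonneg] <;> linarith)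
  have g1 : (p j - p m) ^ μ ≤ ((p n - p m) / 2) ^ μ :=
    Real.rpow_le_rpow (by linarith) h1 (by linarith)
  have g2 : (p n - p (j + 1)) ^ μ ≤ ((p n - p m) / 2) ^ μ :=
    Real.rpow_le_rpow (by linarith) h2 (by linarith)
  have g1' := mul_le_mul_of_nonneg_left g1 hK0
  have g2' := mul_le_mul_of_nonneg_left g2 hK0
  have hh := two_mul_half_rpow (μ := μ) hL
  have hsum : ∑ k ∈ Finset.Ico m n, A (p k) (p (k + 1))
      = ∑ k ∈ Finset.Ico m j, A (p k) (p (k + 1)) + A (p j) (p (j + 1))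
        + ∑ k ∈ Finset.Ico (j + 1) n, A (p k) (p (k + 1)) := by
    rw [← Finset.sum_Ico_consecutive _ hmj hjn.le, Finset.sum_eq_sum_Ico_succ_bot hjn]
    ring
  have hfin : K * (p n - p m) ^ μ
      = 2 * (K * ((p n - p m) / 2) ^ μ) + 2 * (C * (p n - p m) ^ μ) := by
    linear_combination (-(p n - p m) ^ μ) * hKr - K * hh
  rw [hsum, hfin]
  rw [abs_le] at *
  constructor <;> linarith [i1.1, i1.2, i2.1, i2.2, e1.1, e1.2, e2.1, e2.2]

/-- Riemann sum of a germ over the part in `[0,s]` of the dyadic grid of mesh `2⁻ⁿ`. -/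
noncomputable def dyadicSum (A : ℝ → ℝ → ℝ) (n : ℕ) (s : ℝ) : ℝ :=
  ∑ k ∈ Finset.range (2 ^ n), A (min ((k : ℕ) / 2 ^ n) s) (min ((k + 1 : ℕ) / 2 ^ n) s)

lemma min_grid_mem {s : ℝ} (hs : s ∈ Icc (0 : ℝ) 1) (k n : ℕ) :
    min ((k : ℝ) / 2 ^ n) s ∈ Icc (0 : ℝ) 1 :=
  ⟨le_min (by positivity) hs.1, (min_le_right _ _).trans hs.2⟩

lemma abs_min_sub_min_le (a b s : ℝ) : |min a s - min b s| ≤ |a - b| := by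
  simpa using abs_min_sub_min_le_max a s b s

lemma sum_range_two_mul (f : ℕ → ℝ) (N : ℕ) :
    ∑ k ∈ Finset.range (2 * N), f k = ∑ k ∈ Finset.range N, (f (2 * k) + f (2 * k + 1)) := by
  induction N with
  | zero => simp
  | succ N ih =>
    rw [show 2 * (N + 1) = 2 * N + 1 + 1 by ring, Finset.sum_range_succ, Finset.sum_range_succ,
      ih, Finset.sum_range_succ]
    ring

lemma IsSewable.dist_dyadicSum_succ_le {A : ℝ → ℝ → ℝ} {C μ : ℝ} (hA : IsSewable A C μ)
    {s : ℝ} (hs : s ∈ Icc (0 : ℝ) 1) (n : ℕ) :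
    dist (dyadicSum A n s) (dyadicSum A (n + 1) s) ≤ C * dyadicRatio μ ^ n := by
  have hterm : ∀ k : ℕ, |A (min ((k : ℕ) / 2 ^ n) s) (min ((k + 1 : ℕ) / 2 ^ n) s)
      - (A (min ((2 * k : ℕ) / 2 ^ (n + 1)) s) (min ((2 * k + 1 : ℕ) / 2 ^ (n + 1)) s)
        + A (min ((2 * k + 1 : ℕ) / 2 ^ (n + 1)) s)
          (min ((2 * k + 1 + 1 : ℕ) / 2 ^ (n + 1)) s))| ≤ C * (1 / 2 ^ n : ℝ) ^ μ := by
    intro k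
    have e1 : ((2 * k : ℕ) : ℝ) / 2 ^ (n + 1) = (k : ℕ) / 2 ^ n := by
      push_cast; rw [pow_succ]; field_simp
    have e2 : ((2 * k + 1 + 1 : ℕ) : ℝ) / 2 ^ (n + 1) = (k + 1 : ℕ) / 2 ^ n := by
      push_cast; rw [pow_succ]; field_simp; ring
    have hd : (1 : ℝ) / 2 ^ (n + 1) ≤ 1 / 2 ^ n := by
      apply one_div_le_one_div_of_le (by positivity)
      exact pow_le_pow_right₀ (by norm_num) (by omega)
    have hstep : ∀ i : ℕ, |min (((i + 1 : ℕ) : ℝ) / 2 ^ (n + 1)) s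
        - min ((i : ℝ) / 2 ^ (n + 1)) s| ≤ 1 / 2 ^ n := by
      intro i
      refine (abs_min_sub_min_le _ _ _).trans (le_trans (le_of_eq ?_) hd)
      rw [← sub_div, abs_of_nonneg] <;> push_cast <;> ring_nf <;> positivity
    have := hA.defect _ (min_grid_mem hs (2 * k) (n + 1)) _
      (min_grid_mem hs (2 * k + 1) (n + 1)) _ (min_grid_mem hs (2 * k + 1 + 1) (n + 1))
      (1 / 2 ^ n) (hstep _) (hstep _)
    rw [e1, e2]
    rwa [sub_sub, e1, e2] at this
  rw [Real.dist_eq, dyadicSum, dyadicSum, pow_succ', sum_range_two_mul,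
    ← Finset.sum_sub_distrib]
  refine (Finset.abs_sum_le_sum_abs _ _).trans ((Finset.sum_le_sum fun k _ => hterm k).trans ?_)
  rw [Finset.sum_const, Finset.card_range, nsmul_eq_mul, ← two_pow_mul_rpow]
  push_cast
  exact le_of_eq (by ring)

/-- The sewn integral over `[0,s]`. -/
noncomputable def sewn (A : ℝ → ℝ → ℝ) (s : ℝ) : ℝ :=
  limUnder atTop fun n => dyadicSum A n s

lemma IsSewable.tendsto_sewn {A : ℝ → ℝ → ℝ} {C μ : ℝ} (hA : IsSewable A C μ)
    (hμ : 1 < μ) {s : ℝ} (hs : s ∈ Icc (0 : ℝ) 1) :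
    Tendsto (fun n => dyadicSum A n s) atTop (𝓝 (sewn A s)) :=
  (cauchySeq_of_le_geometric _ C (dyadicRatio_lt_one hμ)
    (hA.dist_dyadicSum_succ_le hs)).tendsto_limUnder

lemma IsSewable.dist_dyadicSum_sewn_le {A : ℝ → ℝ → ℝ} {C μ : ℝ} (hA : IsSewable A C μ)
    (hμ : 1 < μ) {s : ℝ} (hs : s ∈ Icc (0 : ℝ) 1) (n : ℕ) :
    dist (dyadicSum A n s) (sewn A s) ≤ C * dyadicRatio μ ^ n / (1 - dyadicRatio μ) :=
  dist_le_of_le_geometric_of_tendsto _ C (dyadicRatio_lt_one hμ)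
    (hA.dist_dyadicSum_succ_le hs) (hA.tendsto_sewn hμ hs) n

lemma IsSewable.abs_dyadicSum_sub_le {A : ℝ → ℝ → ℝ} {C μ : ℝ} (hA : IsSewable A C μ)
    (hC : 0 ≤ C) (hμ : 1 < μ) {s s' : ℝ} (hs : s ∈ Icc (0 : ℝ) 1) (hs' : s' ∈ Icc (0 : ℝ) 1)
    (hss : s ≤ s') (n : ℕ) :
    |dyadicSum A n s' - dyadicSum A n s - A s s'|
      ≤ C * dyadicRatio μ ^ n + 2 * C / (1 - dyadicRatio μ) * (s' - s) ^ μ := by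
  set p : ℕ → ℝ := fun k => (k : ℝ) / 2 ^ n with hp
  set q : ℕ → ℝ := fun k => max s (min (p k) s') with hq
  have hpmono : Monotone p := fun a b hab => by
    simp only [hp]; gcongr
  have hqmono : Monotone q := fun a b hab =>
    max_le_max le_rfl (min_le_min (hpmono hab) le_rfl)
  have hqmem : ∀ k, q k ∈ Icc (0 : ℝ) 1 := fun k =>
    ⟨le_max_of_le_left hs.1, max_le hs.2 ((min_le_right _ _).trans hs'.2)⟩
  have hp0 : ∀ k, 0 ≤ p k := fun k => by simp only [hp]; positivity
  have hq0 : q 0 = s := by simp [hq, hp, hs'.1, hs.1]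
  have hqn : q (2 ^ n) = s' := by simp [hq, hp, hs'.2, hss]
  have hstep : ∀ k, p (k + 1) - p k = 1 / 2 ^ n := fun k => by
    simp only [hp]; push_cast; ring
  have hC' : 0 ≤ C * (1 / 2 ^ n : ℝ) ^ μ := by positivity
  have hterm : ∀ k, |A (min (p k) s') (min (p (k + 1)) s') - A (min (p k) s) (min (p (k + 1)) s)
      - A (q k) (q (k + 1))| ≤ C * (1 / 2 ^ n : ℝ) ^ μ := by
    intro k
    have hk : p k ≤ p (k + 1) := hpmono (by omega)
    have hkk := hstep k
    rcases le_total (p (k + 1)) s with h1 | h1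
    · have h2 := hk.trans h1
      simp only [hq]
      rw [min_eq_left (h1.trans hss), min_eq_left (h2.trans hss), min_eq_left h1,
        min_eq_left h2, max_eq_left h1, max_eq_left h2, hA.diag s hs]
      simpa using hC'
    rcases le_total s (p k) with h2 | h2
    · simp only [hq]
      rw [max_eq_right (le_min h2 hss), max_eq_right (le_min h1 hss), min_eq_right h1,
        min_eq_right h2, hA.diag s hs]
      simpa using hC'
    · simp only [hq]
      rw [max_eq_right (le_min h1 hss), min_eq_left (h2.trans hss), min_eq_left h2,
        min_eq_right h1, max_eq_left h2]
      have hle : min (p (k + 1)) s' ≤ p (k + 1) := min_le_left _ _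
      have hge : s ≤ min (p (k + 1)) s' := le_min h1 hss
      exact hA.defect _ ⟨hp0 k, h2.trans hs.2⟩ _ hs _ ⟨hs.1.trans hge,
        (min_le_right _ _).trans hs'.2⟩ _
        (by rw [abs_of_nonneg] <;> linarith) (by rw [abs_of_nonneg] <;> linarith)
  have hsum : |dyadicSum A n s' - dyadicSum A n s
      - ∑ k ∈ Finset.range (2 ^ n), A (q k) (q (k + 1))| ≤ C * dyadicRatio μ ^ n := by
    rw [dyadicSum, dyadicSum, ← Finset.sum_sub_distrib, ← Finset.sum_sub_distrib]
    refine (Finset.abs_sum_le_sum_abs _ _).trans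
      ((Finset.sum_le_sum fun k _ => hterm k).trans ?_)
    rw [Finset.sum_const, Finset.card_range, nsmul_eq_mul, ← two_pow_mul_rpow]
    push_cast
    exact le_of_eq (by ring)
  have hmax := hA.abs_sum_sub_le hC hμ hqmono hqmem 0 (2 ^ n)
  rw [zero_add, hq0, hqn, ← Finset.range_eq_Ico] at hmax
  rw [abs_le] at *
  constructor <;> linarith [hsum.1, hsum.2, hmax.1, hmax.2]

/-- **Sewing lemma.** -/
lemma IsSewable.abs_sewn_sub_le {A : ℝ → ℝ → ℝ} {C μ : ℝ} (hA : IsSewable A C μ)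
    (hC : 0 ≤ C) (hμ : 1 < μ) {s s' : ℝ} (hs : s ∈ Icc (0 : ℝ) 1) (hs' : s' ∈ Icc (0 : ℝ) 1) :
    |sewn A s' - sewn A s - A s s'|
      ≤ (2 * C / (1 - dyadicRatio μ) + C) * |s' - s| ^ μ := by
  have key : ∀ s ∈ Icc (0 : ℝ) 1, ∀ s' ∈ Icc (0 : ℝ) 1, s ≤ s' →
      |sewn A s' - sewn A s - A s s'| ≤ 2 * C / (1 - dyadicRatio μ) * (s' - s) ^ μ := by
    intro s hs s' hs' hss
    have hl := (((hA.tendsto_sewn hμ hs').sub (hA.tendsto_sewn hμ hs)).sub_const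
      (A s s')).abs
    have hr : Tendsto (fun n : ℕ => C * dyadicRatio μ ^ n
        + 2 * C / (1 - dyadicRatio μ) * (s' - s) ^ μ) atTop
        (𝓝 (C * 0 + 2 * C / (1 - dyadicRatio μ) * (s' - s) ^ μ)) :=
      ((tendsto_pow_atTop_nhds_zero_of_lt_one (dyadicRatio_pos μ).le
        (dyadicRatio_lt_one hμ)).const_mul C).add_const _
    rw [mul_zero, zero_add] at hr
    exact le_of_tendsto_of_tendsto' hl hr (hA.abs_dyadicSum_sub_le hC hμ hs hs' hss)
  have hpow : 0 ≤ C * |s' - s| ^ μ := by positivity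
  rcases le_total s s' with h | h
  · have := key s hs s' hs' h
    rw [abs_of_nonneg (sub_nonneg.mpr h)] at hpow ⊢
    linarith
  · have h1 := key s' hs' s hs h
    have h2 := hA.defect s hs s' hs' s hs |s' - s| le_rfl (abs_sub_comm s s').le
    rw [hA.diag s hs] at h2
    rw [← abs_of_nonneg (sub_nonneg.mpr h), abs_sub_comm s s'] at h1
    rw [add_mul]
    rw [abs_le] at h1 h2 ⊢
    constructor <;> linarith [h1.1, h1.2, h2.1, h2.2]

/-- The sewn integral depends continuously on its endpoint and on a parameter. -/
lemma continuousOn_sewn {T : Type*} [TopologicalSpace T] {S : Set T} {A : T → ℝ → ℝ → ℝ}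
    {C μ : ℝ} (hμ : 1 < μ) (hA : ∀ t ∈ S, IsSewable (A t) C μ)
    (hcont : ContinuousOn (fun q : (ℝ × ℝ) × T => A q.2 q.1.1 q.1.2)
      ((Icc 0 1 ×ˢ Icc 0 1) ×ˢ S)) :
    ContinuousOn (fun q : ℝ × T => sewn (A q.2) q.1) (Icc 0 1 ×ˢ S) := by
  have hunif : TendstoUniformlyOn (fun n (q : ℝ × T) => dyadicSum (A q.2) n q.1)
      (fun q => sewn (A q.2) q.1) atTop (Icc 0 1 ×ˢ S) := by
    rw [Metric.tendstoUniformlyOn_iff]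
    intro ε hε
    have hlim : Tendsto (fun n : ℕ => C * dyadicRatio μ ^ n / (1 - dyadicRatio μ)) atTop
        (𝓝 (C * 0 / (1 - dyadicRatio μ))) :=
      ((tendsto_pow_atTop_nhds_zero_of_lt_one (dyadicRatio_pos μ).le
        (dyadicRatio_lt_one hμ)).const_mul C).div_const _
    rw [mul_zero, zero_div] at hlim
    filter_upwards [hlim.eventually_lt_const hε] with n hn q hq
    rw [dist_comm]
    exact ((hA q.2 hq.2).dist_dyadicSum_sewn_le hμ hq.1 n).trans_lt hn
  refine hunif.continuousOn (Eventually.of_forall fun n => ?_).frequently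
  unfold dyadicSum
  refine continuousOn_finsetSum _ fun k _ => ?_
  refine hcont.comp (f := fun q : ℝ × T => ((min ((k : ℝ) / 2 ^ n) q.1,
    min (((k + 1 : ℕ) : ℝ) / 2 ^ n) q.1), q.2)) (by fun_prop) ?_
  exact fun q hq => ⟨⟨min_grid_mem hq.1 _ _, min_grid_mem hq.1 _ _⟩, hq.2⟩

/-- An additive function of intervals bounded by a power greater than one of the length is zero. -/
lemma eq_zero_of_additive_of_abs_le {D : ℝ → ℝ → ℝ} {C μ : ℝ} (hμ : 1 < μ)
    (hadd : ∀ a ∈ Icc (0 : ℝ) 1, ∀ b ∈ Icc (0 : ℝ) 1, ∀ c ∈ Icc (0 : ℝ) 1,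
      D a c = D a b + D b c)
    (hD : ∀ a ∈ Icc (0 : ℝ) 1, ∀ b ∈ Icc (0 : ℝ) 1, |D a b| ≤ C * |b - a| ^ μ)
    {a b : ℝ} (ha : a ∈ Icc (0 : ℝ) 1) (hb : b ∈ Icc (0 : ℝ) 1) : D a b = 0 := by
  have key : ∀ n : ℕ, ∀ a ∈ Icc (0 : ℝ) 1, ∀ b ∈ Icc (0 : ℝ) 1,
      |D a b| ≤ C * |b - a| ^ μ * dyadicRatio μ ^ n := by
    intro n
    induction n with
    | zero => simpa using hD
    | succ n ih =>
      intro a ha b hb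
      have hm : (a + b) / 2 ∈ Icc (0 : ℝ) 1 :=
        ⟨by linarith [ha.1, hb.1], by linarith [ha.2, hb.2]⟩
      have h1 := ih a ha _ hm
      have h2 := ih _ hm b hb
      rw [show (a + b) / 2 - a = (b - a) / 2 by ring, abs_div, abs_two] at h1
      rw [show b - (a + b) / 2 = (b - a) / 2 by ring, abs_div, abs_two] at h2
      rw [hadd a ha _ hm b hb]
      have hh := two_mul_half_rpow (μ := μ) (abs_nonneg (b - a))
      have : C * |b - a| ^ μ * dyadicRatio μ ^ (n + 1)
          = 2 * (C * (|b - a| / 2) ^ μ * dyadicRatio μ ^ n) := by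
        rw [pow_succ]
        linear_combination (-C * dyadicRatio μ ^ n) * hh
      rw [this]
      exact (abs_add_le _ _).trans (by linarith)
  have hlim : Tendsto (fun n : ℕ => C * |b - a| ^ μ * dyadicRatio μ ^ n) atTop
      (𝓝 (C * |b - a| ^ μ * 0)) :=
    (tendsto_pow_atTop_nhds_zero_of_lt_one (dyadicRatio_pos μ).le
      (dyadicRatio_lt_one hμ)).const_mul _
  rw [mul_zero] at hlim
  exact abs_nonpos_iff.mp (ge_of_tendsto' hlim fun n => key n a ha b hb)

/-- **The boundary rough integral `∫₁ y ∫₂ dx`.**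
Given `1/3 < α ≤ 1`, `0 < β ≤ 1`, a sheet `x` with `‖δx‖_{α,β} < ∞`, a path `y`
controlled by `x` in the first direction with derivative `v`, and an area-type
biincrement `B` with the Chen relation, there is a unique continuous `I` vanishing on
degenerate rectangles, additive in the first direction, and such that
`I − y δx − v B` is `O(|s₂−s₁|^{3α}|t₂−t₁|^{β})`. -/
theorem stmt8
    (α β : ℝ) (hα : 1/3 < α) (hα1 : α ≤ 1) (hβ : 0 < β) (hβ1 : β ≤ 1)
    (x y v : ℝ → ℝ → ℝ)
    (hxc : ContinuousOn (fun q : ℝ × ℝ => x q.1 q.2) (Icc 0 1 ×ˢ Icc 0 1))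
    (hyc : ContinuousOn (fun q : ℝ × ℝ => y q.1 q.2) (Icc 0 1 ×ˢ Icc 0 1))
    (hvc : ContinuousOn (fun q : ℝ × ℝ => v q.1 q.2) (Icc 0 1 ×ˢ Icc 0 1))
    (hδx : ∃ C : ℝ, ∀ s₁ s₂ t₁ t₂ : ℝ, s₁ ∈ Icc (0:ℝ) 1 → s₂ ∈ Icc (0:ℝ) 1 →
      t₁ ∈ Icc (0:ℝ) 1 → t₂ ∈ Icc (0:ℝ) 1 →
      |dd x s₁ s₂ t₁ t₂| ≤ C * |s₂ - s₁| ^ α * |t₂ - t₁| ^ β)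
    (hvbdd : ∃ C : ℝ, ∀ s t : ℝ, s ∈ Icc (0:ℝ) 1 → t ∈ Icc (0:ℝ) 1 → |v s t| ≤ C)
    (hδ₁v : ∃ C : ℝ, ∀ s₁ s₂ t : ℝ, s₁ ∈ Icc (0:ℝ) 1 → s₂ ∈ Icc (0:ℝ) 1 →
      t ∈ Icc (0:ℝ) 1 → |v s₂ t - v s₁ t| ≤ C * |s₂ - s₁| ^ α)
    (hsharp : ∃ C : ℝ, ∀ s₁ s₂ t : ℝ, s₁ ∈ Icc (0:ℝ) 1 → s₂ ∈ Icc (0:ℝ) 1 →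
      t ∈ Icc (0:ℝ) 1 →
      |y s₂ t - y s₁ t - v s₁ t * (x s₂ t - x s₁ t)| ≤ C * |s₂ - s₁| ^ (2 * α))
    (B : ℝ → ℝ → ℝ → ℝ → ℝ)
    (hBc : ContinuousOn (fun q : (ℝ × ℝ) × ℝ × ℝ => B q.1.1 q.1.2 q.2.1 q.2.2)
      ((Icc 0 1 ×ˢ Icc 0 1) ×ˢ (Icc 0 1 ×ˢ Icc 0 1)))
    (hB0 : ∀ s₁ s₂ t₁ t₂ : ℝ, s₁ ∈ Icc (0:ℝ) 1 → s₂ ∈ Icc (0:ℝ) 1 →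
      t₁ ∈ Icc (0:ℝ) 1 → t₂ ∈ Icc (0:ℝ) 1 → (s₁ = s₂ ∨ t₁ = t₂) →
      B s₁ s₂ t₁ t₂ = 0)
    (hBb : ∃ C : ℝ, ∀ s₁ s₂ t₁ t₂ : ℝ, s₁ ∈ Icc (0:ℝ) 1 → s₂ ∈ Icc (0:ℝ) 1 →
      t₁ ∈ Icc (0:ℝ) 1 → t₂ ∈ Icc (0:ℝ) 1 →
      |B s₁ s₂ t₁ t₂| ≤ C * |s₂ - s₁| ^ (2 * α) * |t₂ - t₁| ^ β)
    (hChen : ∀ s₁ s₂ s₃ t₁ t₂ : ℝ, s₁ ∈ Icc (0:ℝ) 1 → s₂ ∈ Icc (0:ℝ) 1 →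
      s₃ ∈ Icc (0:ℝ) 1 → t₁ ∈ Icc (0:ℝ) 1 → t₂ ∈ Icc (0:ℝ) 1 →
      B s₁ s₃ t₁ t₂ - B s₁ s₂ t₁ t₂ - B s₂ s₃ t₁ t₂
        = (x s₂ t₁ - x s₁ t₁) * dd x s₂ s₃ t₁ t₂) :
    ∃ I : ℝ → ℝ → ℝ → ℝ → ℝ,
      (ContinuousOn (fun q : (ℝ × ℝ) × ℝ × ℝ => I q.1.1 q.1.2 q.2.1 q.2.2)
          ((Icc 0 1 ×ˢ Icc 0 1) ×ˢ (Icc 0 1 ×ˢ Icc 0 1)) ∧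
        (∀ s₁ s₂ t₁ t₂ : ℝ, s₁ ∈ Icc (0:ℝ) 1 → s₂ ∈ Icc (0:ℝ) 1 →
          t₁ ∈ Icc (0:ℝ) 1 → t₂ ∈ Icc (0:ℝ) 1 → (s₁ = s₂ ∨ t₁ = t₂) →
          I s₁ s₂ t₁ t₂ = 0) ∧
        (∀ s₁ s₂ s₃ t₁ t₂ : ℝ, s₁ ∈ Icc (0:ℝ) 1 → s₂ ∈ Icc (0:ℝ) 1 →
          s₃ ∈ Icc (0:ℝ) 1 → t₁ ∈ Icc (0:ℝ) 1 → t₂ ∈ Icc (0:ℝ) 1 →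
          I s₁ s₃ t₁ t₂ = I s₁ s₂ t₁ t₂ + I s₂ s₃ t₁ t₂) ∧
        (∃ C : ℝ, ∀ s₁ s₂ t₁ t₂ : ℝ, s₁ ∈ Icc (0:ℝ) 1 → s₂ ∈ Icc (0:ℝ) 1 →
          t₁ ∈ Icc (0:ℝ) 1 → t₂ ∈ Icc (0:ℝ) 1 →
          |I s₁ s₂ t₁ t₂ - y s₁ t₁ * dd x s₁ s₂ t₁ t₂ - v s₁ t₁ * B s₁ s₂ t₁ t₂|
            ≤ C * |s₂ - s₁| ^ (3 * α) * |t₂ - t₁| ^ β)) ∧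
      (∀ I' : ℝ → ℝ → ℝ → ℝ → ℝ,
        (ContinuousOn (fun q : (ℝ × ℝ) × ℝ × ℝ => I' q.1.1 q.1.2 q.2.1 q.2.2)
            ((Icc 0 1 ×ˢ Icc 0 1) ×ˢ (Icc 0 1 ×ˢ Icc 0 1)) ∧
          (∀ s₁ s₂ t₁ t₂ : ℝ, s₁ ∈ Icc (0:ℝ) 1 → s₂ ∈ Icc (0:ℝ) 1 →
            t₁ ∈ Icc (0:ℝ) 1 → t₂ ∈ Icc (0:ℝ) 1 → (s₁ = s₂ ∨ t₁ = t₂) →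
            I' s₁ s₂ t₁ t₂ = 0) ∧
          (∀ s₁ s₂ s₃ t₁ t₂ : ℝ, s₁ ∈ Icc (0:ℝ) 1 → s₂ ∈ Icc (0:ℝ) 1 →
            s₃ ∈ Icc (0:ℝ) 1 → t₁ ∈ Icc (0:ℝ) 1 → t₂ ∈ Icc (0:ℝ) 1 →
            I' s₁ s₃ t₁ t₂ = I' s₁ s₂ t₁ t₂ + I' s₂ s₃ t₁ t₂) ∧
          (∃ C : ℝ, ∀ s₁ s₂ t₁ t₂ : ℝ, s₁ ∈ Icc (0:ℝ) 1 → s₂ ∈ Icc (0:ℝ) 1 →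
            t₁ ∈ Icc (0:ℝ) 1 → t₂ ∈ Icc (0:ℝ) 1 →
            |I' s₁ s₂ t₁ t₂ - y s₁ t₁ * dd x s₁ s₂ t₁ t₂ - v s₁ t₁ * B s₁ s₂ t₁ t₂|
              ≤ C * |s₂ - s₁| ^ (3 * α) * |t₂ - t₁| ^ β)) →
        ∀ s₁ s₂ t₁ t₂ : ℝ, s₁ ∈ Icc (0:ℝ) 1 → s₂ ∈ Icc (0:ℝ) 1 →
          t₁ ∈ Icc (0:ℝ) 1 → t₂ ∈ Icc (0:ℝ) 1 →
          I' s₁ s₂ t₁ t₂ = I s₁ s₂ t₁ t₂) := by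
  obtain ⟨Cx, hx⟩ := hδx
  obtain ⟨Cv, hv⟩ := hδ₁v
  obtain ⟨Cs, hs⟩ := hsharp
  obtain ⟨CB, hB⟩ := hBb
  have hμ : 1 < 3 * α := by linarith
  set A : ℝ × ℝ → ℝ → ℝ → ℝ := fun t a b =>
    y a t.1 * dd x a b t.1 t.2 + v a t.1 * B a b t.1 t.2 with hAdef
  set M := |Cs| * |Cx| + |Cv| * |CB| with hM
  have hM0 : 0 ≤ M := by positivity
  have hsew : ∀ t ∈ Icc (0:ℝ) 1 ×ˢ Icc (0:ℝ) 1,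
      IsSewable (A t) (M * |t.2 - t.1| ^ β) (3 * α) := by
    rintro ⟨t₁, t₂⟩ ⟨ht₁, ht₂⟩
    refine ⟨fun a ha => ?_, fun a ha b hb c hc D hab hbc => ?_⟩
    · simp [hAdef, dd, hB0 a a t₁ t₂ ha ha ht₁ ht₂ (Or.inl rfl)]
    · have hD : 0 ≤ D := (abs_nonneg _).trans hab
      have p1 : |b - a| ^ α ≤ D ^ α := Real.rpow_le_rpow (abs_nonneg _) hab (by linarith)
      have p2 : |b - a| ^ (2 * α) ≤ D ^ (2 * α) :=
        Real.rpow_le_rpow (abs_nonneg _) hab (by linarith)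
      have p3 : |c - b| ^ α ≤ D ^ α := Real.rpow_le_rpow (abs_nonneg _) hbc (by linarith)
      have p4 : |c - b| ^ (2 * α) ≤ D ^ (2 * α) :=
        Real.rpow_le_rpow (abs_nonneg _) hbc (by linarith)
      have hDD : D ^ (3 * α) = D ^ (2 * α) * D ^ α := by
        rw [← Real.rpow_add_of_nonneg hD (by linarith) (by linarith)]
        ring_nf
      have q1 : |y b t₁ - y a t₁ - v a t₁ * (x b t₁ - x a t₁)| ≤ |Cs| * D ^ (2 * α) :=
        (hs a b t₁ ha hb ht₁).trans (by gcongr; exact le_abs_self _)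
      have q2 : |dd x b c t₁ t₂| ≤ |Cx| * D ^ α * |t₂ - t₁| ^ β :=
        (hx b c t₁ t₂ hb hc ht₁ ht₂).trans (by gcongr; exact le_abs_self _)
      have q3 : |v b t₁ - v a t₁| ≤ |Cv| * D ^ α :=
        (hv a b t₁ ha hb ht₁).trans (by gcongr; exact le_abs_self _)
      have q4 : |B b c t₁ t₂| ≤ |CB| * D ^ (2 * α) * |t₂ - t₁| ^ β :=
        (hB b c t₁ t₂ hb hc ht₁ ht₂).trans (by gcongr; exact le_abs_self _)
      have hdefect : A (t₁, t₂) a c - A (t₁, t₂) a b - A (t₁, t₂) b c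
          = -((y b t₁ - y a t₁ - v a t₁ * (x b t₁ - x a t₁)) * dd x b c t₁ t₂
            + (v b t₁ - v a t₁) * B b c t₁ t₂) := by
        have hch := hChen a b c t₁ t₂ ha hb hc ht₁ ht₂
        have hdd : dd x a c t₁ t₂ = dd x a b t₁ t₂ + dd x b c t₁ t₂ := by unfold dd; ring
        simp only [hAdef, hdd]
        linear_combination (v a t₁) * hch
      rw [hdefect, abs_neg]
      refine (abs_add_le _ _).trans ?_
      rw [abs_mul, abs_mul]
      calc _ ≤ |Cs| * D ^ (2 * α) * (|Cx| * D ^ α * |t₂ - t₁| ^ β)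
            + |Cv| * D ^ α * (|CB| * D ^ (2 * α) * |t₂ - t₁| ^ β) := by gcongr
        _ = _ := by rw [hDD, hM]; ring
  have hsew' : ∀ t ∈ Icc (0:ℝ) 1 ×ˢ Icc (0:ℝ) 1, IsSewable (A t) M (3 * α) := by
    intro t ht
    refine ⟨(hsew t ht).diag, fun a ha b hb c hc D hab hbc => ?_⟩
    refine ((hsew t ht).defect a ha b hb c hc D hab hbc).trans ?_
    have hD : 0 ≤ D := (abs_nonneg _).trans hab
    have h1 : |t.2 - t.1| ^ β ≤ 1 := Real.rpow_le_one (abs_nonneg _)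
      (abs_le.mpr ⟨by linarith [ht.1.2, ht.2.1], by linarith [ht.1.1, ht.2.2]⟩) hβ.le
    have := mul_le_mul_of_nonneg_left h1 hM0
    rw [mul_one] at this
    gcongr
  have hcomp : ∀ {f : ℝ → ℝ → ℝ}, ContinuousOn (fun q : ℝ × ℝ => f q.1 q.2)
      (Icc 0 1 ×ˢ Icc 0 1) → ∀ {g h : (ℝ × ℝ) × ℝ × ℝ → ℝ}, Continuous g → Continuous h →
      (∀ q ∈ ((Icc 0 1 ×ˢ Icc 0 1) ×ˢ (Icc 0 1 ×ˢ Icc 0 1) : Set ((ℝ × ℝ) × ℝ × ℝ)),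
        g q ∈ Icc (0:ℝ) 1 ∧ h q ∈ Icc (0:ℝ) 1) →
      ContinuousOn (fun q : (ℝ × ℝ) × ℝ × ℝ => f (g q) (h q))
        ((Icc 0 1 ×ˢ Icc 0 1) ×ˢ (Icc 0 1 ×ˢ Icc 0 1)) := by
    intro f hf g h hg hh hm
    exact hf.comp (f := fun q => (g q, h q)) (hg.prodMk hh).continuousOn hm
  have hAc : ContinuousOn (fun q : (ℝ × ℝ) × ℝ × ℝ => A q.2 q.1.1 q.1.2)
      ((Icc 0 1 ×ˢ Icc 0 1) ×ˢ (Icc 0 1 ×ˢ Icc 0 1)) := by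
    have c11 := fun {f : ℝ → ℝ → ℝ} hf => hcomp (f := f) hf (g := fun q => q.1.1)
      (h := fun q => q.2.1) (by fun_prop) (by fun_prop) fun q hq => ⟨hq.1.1, hq.2.1⟩
    have c12 := hcomp hxc (g := fun q => q.1.1)
      (h := fun q => q.2.2) (by fun_prop) (by fun_prop) fun q hq => ⟨hq.1.1, hq.2.2⟩
    have c21 := hcomp hxc (g := fun q => q.1.2)
      (h := fun q => q.2.1) (by fun_prop) (by fun_prop) fun q hq => ⟨hq.1.2, hq.2.1⟩
    have c22 := hcomp hxc (g := fun q => q.1.2)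
      (h := fun q => q.2.2) (by fun_prop) (by fun_prop) fun q hq => ⟨hq.1.2, hq.2.2⟩
    exact ((c11 hyc).mul (((c22.sub c12).sub c21).add (c11 hxc))).add ((c11 hvc).mul hBc)
  have hJc := continuousOn_sewn hμ hsew' hAc
  have hbound : ∀ s₁ s₂ t₁ t₂ : ℝ, s₁ ∈ Icc (0:ℝ) 1 → s₂ ∈ Icc (0:ℝ) 1 →
      t₁ ∈ Icc (0:ℝ) 1 → t₂ ∈ Icc (0:ℝ) 1 →
      |sewn (A (t₁, t₂)) s₂ - sewn (A (t₁, t₂)) s₁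
          - y s₁ t₁ * dd x s₁ s₂ t₁ t₂ - v s₁ t₁ * B s₁ s₂ t₁ t₂|
        ≤ (2 * M / (1 - dyadicRatio (3 * α)) + M) * |s₂ - s₁| ^ (3 * α) * |t₂ - t₁| ^ β := by
    intro s₁ s₂ t₁ t₂ hs₁ hs₂ ht₁ ht₂
    have := (hsew (t₁, t₂) ⟨ht₁, ht₂⟩).abs_sewn_sub_le (by positivity) hμ hs₁ hs₂
    rw [sub_sub]
    exact this.trans (le_of_eq (by ring))
  refine ⟨fun s₁ s₂ t₁ t₂ => sewn (A (t₁, t₂)) s₂ - sewn (A (t₁, t₂)) s₁,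
    ⟨?_, ?_, ?_, _, hbound⟩, ?_⟩
  · refine ContinuousOn.sub
      (hJc.comp (f := fun q : (ℝ × ℝ) × ℝ × ℝ => (q.1.2, q.2)) (by fun_prop)
        fun q hq => ⟨hq.1.2, hq.2⟩)
      (hJc.comp (f := fun q : (ℝ × ℝ) × ℝ × ℝ => (q.1.1, q.2)) (by fun_prop)
        fun q hq => ⟨hq.1.1, hq.2⟩)
  · rintro s₁ s₂ t₁ t₂ hs₁ hs₂ ht₁ ht₂ (rfl | rfl)
    · exact sub_self _
    · have := hbound s₁ s₂ t₁ t₁ hs₁ hs₂ ht₁ ht₁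
      simpa [hB0 s₁ s₂ t₁ t₁ hs₁ hs₂ ht₁ ht₁ (Or.inr rfl), dd, Real.zero_rpow hβ.ne']
        using this
  · intros
    ring
  · rintro I' ⟨-, -, hadd, C', hC'⟩ s₁ s₂ t₁ t₂ hs₁ hs₂ ht₁ ht₂
    refine sub_eq_zero.mp (eq_zero_of_additive_of_abs_le
      (D := fun a b => I' a b t₁ t₂ - (sewn (A (t₁, t₂)) b - sewn (A (t₁, t₂)) a))
      (C := (C' + (2 * M / (1 - dyadicRatio (3 * α)) + M)) * |t₂ - t₁| ^ β) hμ ?_ ?_ hs₁ hs₂)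
    · intro a ha b hb c hc
      simp only [hadd a b c t₁ t₂ ha hb hc ht₁ ht₂]
      ring
    · intro a ha b hb
      have h1 := hC' a b t₁ t₂ ha hb ht₁ ht₂
      have h2 := hbound a b t₁ t₂ ha hb ht₁ ht₂
      have h3 := (abs_sub _ _).trans (add_le_add h1 h2)
      refine le_trans (le_of_eq ?_) (h3.trans (le_of_eq (by ring)))
      congr 1
      ring
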